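/- Let d > 2 be a prime integer. For all n, m ∈ {0,…,d−1}, letting h ∈ {0,…,d−1} be the unique residue with 2h ≡ −n (mod d), one has the explicit identity C_d U_{n,m} C_d = w^{h·m} · Π_{h, (d−m) mod d}. -/

import Mathlib

open Matrix BigOperators

/-- The primitive `d`-th root of unity `w = exp(2πi/d)`. -/
noncomputable def ω (d : ℕ) : ℂ := Complex.exp (2 * Real.pi * Complex.I / d)

/-- The Chrestenson matrix: `(C_d)_{y,x} = w^{x·y} / √d`. -/
noncomputable def chres (d : ℕ) : Matrix (Fin d) (Fin d) ℂ :=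
  Matrix.of fun y x => ω d ^ ((x : ℕ) * (y : ℕ)) / (Real.sqrt d : ℂ)

/-- The Weyl matrix: `(U_{n,m})_{k,j} = w^{k·n}` if `j ≡ k + m (mod d)`, and `0` otherwise. -/
noncomputable def weyl (d n m : ℕ) : Matrix (Fin d) (Fin d) ℂ :=
  Matrix.of fun k j => if (j : ℕ) = ((k : ℕ) + m) % d then ω d ^ ((k : ℕ) * n) else 0

/-- The Kronecker–Pauli matrix: `(Π_{n,m})_{k,j} = w^{(k-n)·m}` if `j ≡ -k + 2n (mod d)`,
and `0` otherwise. -/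
noncomputable def kp (d n m : ℕ) : Matrix (Fin d) (Fin d) ℂ :=
  Matrix.of fun k j =>
    if (j : ℤ) = (-(k : ℤ) + 2 * (n : ℤ)) % (d : ℤ) then ω d ^ (((k : ℤ) - (n : ℤ)) * (m : ℤ))
    else 0

theorem isPrimitiveRoot_ω {d : ℕ} (hd : d ≠ 0) : IsPrimitiveRoot (ω d) d :=
  Complex.isPrimitiveRoot_exp d hd

theorem ω_ne_zero (d : ℕ) : ω d ≠ 0 := Complex.exp_ne_zero _

theorem ω_zpow_eq_of_dvd {d : ℕ} (hd : d ≠ 0) {a b : ℤ} (hab : (d : ℤ) ∣ a - b) :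
    ω d ^ a = ω d ^ b := by
  have h1 : ω d ^ (a - b) = 1 := ((isPrimitiveRoot_ω hd).zpow_eq_one_iff_dvd _).2 hab
  rwa [zpow_sub₀ (ω_ne_zero d), div_eq_one_iff_eq (zpow_ne_zero _ (ω_ne_zero d))] at h1

theorem sum_ω_zpow_mul {d : ℕ} (hd : d ≠ 0) (a : ℤ) :
    ∑ k : Fin d, ω d ^ (a * (k : ℤ)) = if (d : ℤ) ∣ a then (d : ℂ) else 0 := by
  have hpow (k : Fin d) : ω d ^ (a * (k : ℤ)) = (ω d ^ a) ^ (k : ℕ) := by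
    rw [_root_.zpow_mul, zpow_natCast]
  simp_rw [hpow]
  rw [Fin.sum_univ_eq_sum_range (fun k => (ω d ^ a) ^ k) d]
  split_ifs with ha
  · simp [((isPrimitiveRoot_ω hd).zpow_eq_one_iff_dvd a).2 ha]
  · have hne : ω d ^ a ≠ 1 := mt ((isPrimitiveRoot_ω hd).zpow_eq_one_iff_dvd a).1 ha
    rw [geom_sum_eq hne, ← zpow_natCast, ← _root_.zpow_mul,
      ((isPrimitiveRoot_ω hd).zpow_eq_one_iff_dvd _).2 (dvd_mul_left _ _), sub_self, zero_div]

theorem weyl_mul_apply {d : ℕ} (hd : 0 < d) (n m : ℕ) (M : Matrix (Fin d) (Fin d) ℂ)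
    (k z : Fin d) :
    (weyl d n m * M) k z = ω d ^ ((k : ℕ) * n) * M ⟨((k : ℕ) + m) % d, Nat.mod_lt _ hd⟩ z := by
  rw [Matrix.mul_apply, Finset.sum_eq_single ⟨((k : ℕ) + m) % d, Nat.mod_lt _ hd⟩]
  · simp [weyl]
  · intro j _ hj
    have : (j : ℕ) ≠ ((k : ℕ) + m) % d := fun e => hj (Fin.ext e)
    simp [weyl, this]
  · simp

theorem chres_mul_weyl_mul_chres_apply {d : ℕ} (hd : 0 < d) (n m : ℕ) (y z : Fin d) :
    (chres d * weyl d n m * chres d) y z =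
      if (d : ℤ) ∣ (y : ℤ) + n + z then ω d ^ ((m : ℤ) * z) else 0 := by
  have hterm (k : Fin d) : chres d y k * (weyl d n m * chres d) k z =
      ω d ^ ((m : ℤ) * z) / d * ω d ^ (((y : ℤ) + n + z) * (k : ℤ)) := by
    have hsq : (Real.sqrt d : ℂ) * (Real.sqrt d : ℂ) = d := by
      rw [← Complex.ofReal_mul, Real.mul_self_sqrt (Nat.cast_nonneg d), Complex.ofReal_natCast]
    have hmod : ω d ^ ((z : ℕ) * (((k : ℕ) + m) % d)) = ω d ^ ((z : ℤ) * (k + m)) := by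
      rw [← zpow_natCast]
      apply ω_zpow_eq_of_dvd hd.ne'
      push_cast
      rw [← mul_sub]
      exact (Int.mod_modEq _ _).symm.dvd.mul_left _
    have hexp : ω d ^ ((k : ℕ) * (y : ℕ)) * (ω d ^ ((k : ℕ) * n) * ω d ^ ((z : ℤ) * (k + m))) =
        ω d ^ ((m : ℤ) * z) * ω d ^ (((y : ℤ) + n + z) * (k : ℤ)) := by
      simp only [← zpow_natCast, ← zpow_add₀ (ω_ne_zero d)]
      congr 1
      push_cast
      ring
    rw [weyl_mul_apply hd]
    simp only [chres, Matrix.of_apply]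
    rw [hmod, ← mul_div_assoc, div_mul_div_comm, hsq, hexp, div_mul_eq_mul_div]
  have hd0 : (d : ℂ) ≠ 0 := Nat.cast_ne_zero.2 hd.ne'
  rw [Matrix.mul_assoc, Matrix.mul_apply]
  simp_rw [hterm]
  rw [← Finset.mul_sum, sum_ω_zpow_mul hd.ne']
  split_ifs <;> simp [hd0]

theorem chres_weyl_chres_explicit (d : ℕ) (hd : d.Prime) (hd2 : 2 < d)
    (n m h : ℕ) (hn : n < d) (hm : m < d) (hh : h < d)
    (hcong : (2 * (h : ℤ)) % (d : ℤ) = (-(n : ℤ)) % (d : ℤ)) :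
    chres d * weyl d n m * chres d = ω d ^ (h * m) • kp d h ((d - m) % d) := by
  have hd0 : 0 < d := hd.pos
  have hn2 : (d : ℤ) ∣ 2 * h + n := by
    simpa using Int.ModEq.dvd (Eq.symm hcong)
  have hneg : (d : ℤ) ∣ (((d - m) % d : ℕ) : ℤ) + m := by
    rw [← Nat.cast_add, Int.natCast_dvd_natCast, Nat.dvd_iff_mod_eq_zero, Nat.mod_add_mod,
      Nat.sub_add_cancel hm.le, Nat.mod_self]
  ext y z
  have hiff : (z : ℤ) = (-(y : ℤ) + 2 * (h : ℤ)) % (d : ℤ) ↔ (d : ℤ) ∣ (y : ℤ) + n + z := by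
    have hz : (z : ℤ) % d = z :=
      Int.emod_eq_of_lt (Int.natCast_nonneg _) (Int.ofNat_lt.2 z.isLt)
    nth_rewrite 1 [← hz]
    rw [Int.emod_eq_emod_iff_emod_sub_eq_zero, ← Int.dvd_iff_emod_eq_zero, ← dvd_add_left hn2]
    ring_nf
  rw [chres_mul_weyl_mul_chres_apply hd0]
  simp only [kp, Matrix.smul_apply, Matrix.of_apply, smul_eq_mul, hiff]
  split_ifs with hdvd
  · rw [← zpow_natCast, ← zpow_add₀ (ω_ne_zero d)]
    apply ω_zpow_eq_of_dvd hd0.ne'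
    obtain ⟨a, ha⟩ := hn2
    obtain ⟨b, hb⟩ := hneg
    obtain ⟨c, hc⟩ := hdvd
    refine ⟨m * c - m * a - (y - h) * b, ?_⟩
    push_cast at hb ⊢
    linear_combination (m : ℤ) * hc - (m : ℤ) * ha - ((y : ℤ) - h) * hb
  · simp
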